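/- arXiv:2406.11446 — 8 statements merged into one kernel-verified Lean document; each statement's English description precedes it below -/
import Mathlib

section
/- If |k_x| < k, then the point x_s = r₀·(Ω − (k_x/√(k² − k_x²))·√(1 − Ω²)) is a stationary point of the phase function, i.e. ψ'(x_s) = −k_x − k·(x_s − r₀Ω)/r(x_s) = 0. -/
/-- If `|k_x| < k`, then
`x_s = r₀·(Ω − (k_x/√(k² − k_x²))·√(1 − Ω²))` is a stationary point of the
phase function, i.e. `ψ'(x_s) = −k_x − k·(x_s − r₀Ω)/r(x_s) = 0`, where
`k = 2π/λ` and `r(x) = √(r₀² + x² − 2r₀xΩ)`. -/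
theorem stmt_1 (lam : ℝ) (hlam : 0 < lam) (r0 : ℝ) (hr0 : 0 < r0)
    (Ω : ℝ) (hΩ : Ω ∈ Set.Ioo (-1 : ℝ) 1) (kx : ℝ)
    (hkx : |kx| < 2 * Real.pi / lam) :
    -kx - (2 * Real.pi / lam) *
        (r0 * (Ω - kx / Real.sqrt ((2 * Real.pi / lam) ^ 2 - kx ^ 2) *
          Real.sqrt (1 - Ω ^ 2)) - r0 * Ω) /
      Real.sqrt (r0 ^ 2 +
        (r0 * (Ω - kx / Real.sqrt ((2 * Real.pi / lam) ^ 2 - kx ^ 2) *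
          Real.sqrt (1 - Ω ^ 2))) ^ 2 -
        2 * r0 * (r0 * (Ω - kx / Real.sqrt ((2 * Real.pi / lam) ^ 2 - kx ^ 2) *
          Real.sqrt (1 - Ω ^ 2))) * Ω) = 0 := by
  obtain ⟨hΩl, hΩu⟩ := hΩ
  have hk : 0 < 2 * Real.pi / lam := by positivity
  generalize 2 * Real.pi / lam = k at *
  have hsub : 0 < k ^ 2 - kx ^ 2 := by
    have := sq_lt_sq' (abs_lt.mp hkx).1 (abs_lt.mp hkx).2
    linarith
  have hsub' : 0 < 1 - Ω ^ 2 := by nlinarith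
  have ha := Real.sqrt_pos.mpr hsub
  have hs := Real.sqrt_pos.mpr hsub'
  have ha2 := Real.sq_sqrt hsub.le
  have hs2 := Real.sq_sqrt hsub'.le
  generalize Real.sqrt (k ^ 2 - kx ^ 2) = a at *
  generalize Real.sqrt (1 - Ω ^ 2) = s at *
  have hr : r0 ^ 2 + (r0 * (Ω - kx / a * s)) ^ 2 - 2 * r0 * (r0 * (Ω - kx / a * s)) * Ω
      = (r0 * s * k / a) ^ 2 := by
    field_simp
    linear_combination (-a ^ 2) * hs2 + s ^ 2 * ha2
  rw [hr, Real.sqrt_sq (by positivity)]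
  field_simp
  ring
end

section
/- Let δ = D/(2r₀). For every k_x ∈ (−k, k), the stationary point x_s(k_x) lies in the array interval [−D/2, D/2] if and only if k·(Ω − δ)/√(1 + δ² − 2δΩ) ≤ k_x ≤ k·(Ω + δ)/√(1 + δ² + 2δΩ). -/
theorem sin_arctan_div (a : ℝ) {s : ℝ} (hs : 0 < s) :
    Real.sin (Real.arctan (a / s)) = a / Real.sqrt (a ^ 2 + s ^ 2) := by
  have h : 1 + (a / s) ^ 2 = (a ^ 2 + s ^ 2) / s ^ 2 := by
    field_simp
    ring
  rw [Real.sin_arctan, h, Real.sqrt_div (by positivity), Real.sqrt_sq hs.le]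
  field_simp

theorem sin_arctan_strictMono : StrictMono fun x : ℝ => Real.sin (Real.arctan x) :=
  fun x y hxy => Real.strictMonoOn_sin
    ⟨(Real.neg_pi_div_two_lt_arctan x).le, (Real.arctan_lt_pi_div_two x).le⟩
    ⟨(Real.neg_pi_div_two_lt_arctan y).le, (Real.arctan_lt_pi_div_two y).le⟩
    (Real.arctan_strictMono hxy)

theorem div_le_div_iff_div_hypotenuse_le (a b : ℝ) {s q : ℝ} (hs : 0 < s) (hq : 0 < q) :
    a / s ≤ b / q ↔ a / Real.sqrt (a ^ 2 + s ^ 2) ≤ b / Real.sqrt (b ^ 2 + q ^ 2) := by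
  rw [← sin_arctan_div a hs, ← sin_arctan_div b hq]
  exact sin_arctan_strictMono.le_iff_le.symm

/-- Let `δ = D/(2r₀)`. For every `k_x ∈ (−k, k)` (with `k = 2π/λ`),
the stationary point `x_s(k_x) = r₀·(Ω − (k_x/√(k² − k_x²))·√(1 − Ω²))` lies in
the array interval `[−D/2, D/2]` iff
`k·(Ω − δ)/√(1 + δ² − 2δΩ) ≤ k_x ≤ k·(Ω + δ)/√(1 + δ² + 2δΩ)`. -/
theorem stmt_7 (lam : ℝ) (hlam : 0 < lam) (r0 : ℝ) (hr0 : 0 < r0)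
    (Ω : ℝ) (hΩ : Ω ∈ Set.Ioo (-1 : ℝ) 1) (D : ℝ) (hD : 0 < D)
    (δ : ℝ) (hδ : δ = D / (2 * r0)) (kx : ℝ)
    (hkx : kx ∈ Set.Ioo (-(2 * Real.pi / lam)) (2 * Real.pi / lam)) :
    r0 * (Ω - kx / Real.sqrt ((2 * Real.pi / lam) ^ 2 - kx ^ 2) *
        Real.sqrt (1 - Ω ^ 2)) ∈ Set.Icc (-(D / 2)) (D / 2) ↔
      (2 * Real.pi / lam) * (Ω - δ) / Real.sqrt (1 + δ ^ 2 - 2 * δ * Ω) ≤ kx ∧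
      kx ≤ (2 * Real.pi / lam) * (Ω + δ) / Real.sqrt (1 + δ ^ 2 + 2 * δ * Ω) := by
  have hk : 0 < 2 * Real.pi / lam := by positivity
  generalize 2 * Real.pi / lam = k at hkx hk ⊢
  obtain ⟨hΩ₁, hΩ₂⟩ := hΩ
  obtain ⟨hkx₁, hkx₂⟩ := hkx
  have hs2 : 0 < 1 - Ω ^ 2 := by nlinarith
  have hq2 : 0 < k ^ 2 - kx ^ 2 := by nlinarith
  have hs := Real.sqrt_pos.2 hs2
  have hq := Real.sqrt_pos.2 hq2
  have hss := Real.sq_sqrt hs2.le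
  have hqq := Real.sq_sqrt hq2.le
  set s := Real.sqrt (1 - Ω ^ 2)
  set q := Real.sqrt (k ^ 2 - kx ^ 2)
  have hD2 : D / 2 = r0 * δ := by
    rw [hδ]
    field_simp
  have hkq : Real.sqrt (kx ^ 2 + q ^ 2) = k := by
    rw [hqq, add_sub_cancel, Real.sqrt_sq hk.le]
  have hminus : (Ω - δ) ^ 2 + s ^ 2 = 1 + δ ^ 2 - 2 * δ * Ω := by
    rw [hss]
    ring
  have hplus : (Ω + δ) ^ 2 + s ^ 2 = 1 + δ ^ 2 + 2 * δ * Ω := by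
    rw [hss]
    ring
  have hlower := div_le_div_iff_div_hypotenuse_le (Ω - δ) kx hs hq
  have hupper := div_le_div_iff_div_hypotenuse_le kx (Ω + δ) hq hs
  rw [hkq, hminus, le_div_iff₀ hk, div_le_iff₀ hs] at hlower
  rw [hkq, hplus, div_le_iff₀ hk, le_div_iff₀ hs] at hupper
  rw [Set.mem_Icc, hD2, ← mul_neg, mul_le_mul_iff_right₀ hr0, mul_le_mul_iff_right₀ hr0,
    mul_div_assoc, mul_div_assoc, mul_comm k, mul_comm k, ← hlower, ← hupper, and_comm]
  refine and_congr ?_ ?_ <;> constructor <;> intro h <;> linarith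
end

section
/- For every δ > 0, the wave-number k·Ω lies strictly inside the diffusion interval, i.e. k·(Ω − δ)/√(1 + δ² − 2δΩ) < k·Ω < k·(Ω + δ)/√(1 + δ² + 2δΩ). -/
/-- The cosine of an angle strictly increases when the source point is shifted by `δ > 0`
along the axis. -/
theorem lt_add_div_sqrt {x δ : ℝ} (hx : x ∈ Set.Ioo (-1 : ℝ) 1) (hδ : 0 < δ) :
    x < (x + δ) / √(1 + δ ^ 2 + 2 * δ * x) := by
  obtain ⟨h₁, h₂⟩ := hx
  have hc : 0 < 1 - x ^ 2 := by nlinarith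
  have hS : 0 < 1 + δ ^ 2 + 2 * δ * x := by nlinarith [sq_nonneg (x + δ)]
  have hs := Real.sqrt_pos.2 hS
  have hsq := Real.sq_sqrt hS.le
  rw [lt_div_iff₀ hs]
  set s := √(1 + δ ^ 2 + 2 * δ * x)
  have key : (x * s) ^ 2 - (x + δ) ^ 2 = (1 - x ^ 2) * (x ^ 2 - (x + δ) ^ 2) := by
    rw [mul_pow, hsq]; ring
  rcases lt_or_ge 0 x with hx | hx
  · refine lt_of_pow_lt_pow_left₀ 2 (by linarith) ?_
    have : 0 < (1 - x ^ 2) * ((x + δ) ^ 2 - x ^ 2) := mul_pos hc (by nlinarith)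
    linarith
  · rcases lt_or_ge 0 (x + δ) with ht | ht
    · exact (mul_nonpos_of_nonpos_of_nonneg hx hs.le).trans_lt ht
    · have : 0 < (1 - x ^ 2) * (x ^ 2 - (x + δ) ^ 2) := mul_pos hc (by nlinarith)
      have := lt_of_pow_lt_pow_left₀ (a := -(x + δ)) (b := -(x * s)) 2
        (neg_nonneg.2 (mul_nonpos_of_nonpos_of_nonneg hx hs.le))
        (by rw [neg_sq, neg_sq]; linarith)
      linarith

/-- For every `δ > 0`, the wave-number `k·Ω` (with `k = 2π/λ`)
lies strictly inside the diffusion interval: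
`k·(Ω − δ)/√(1 + δ² − 2δΩ) < k·Ω < k·(Ω + δ)/√(1 + δ² + 2δΩ)`. -/
theorem stmt_8 (lam : ℝ) (hlam : 0 < lam) (Ω : ℝ) (hΩ : Ω ∈ Set.Ioo (-1 : ℝ) 1)
    (δ : ℝ) (hδ : 0 < δ) :
    (2 * Real.pi / lam) * (Ω - δ) / Real.sqrt (1 + δ ^ 2 - 2 * δ * Ω) <
        (2 * Real.pi / lam) * Ω ∧
      (2 * Real.pi / lam) * Ω <
        (2 * Real.pi / lam) * (Ω + δ) / Real.sqrt (1 + δ ^ 2 + 2 * δ * Ω) := by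
  have hk : 0 < 2 * Real.pi / lam := by positivity
  have hneg : -Ω ∈ Set.Ioo (-1 : ℝ) 1 := ⟨by linarith [hΩ.2], by linarith [hΩ.1]⟩
  have hl := lt_add_div_sqrt hneg hδ
  rw [show 1 + δ ^ 2 + 2 * δ * -Ω = 1 + δ ^ 2 - 2 * δ * Ω by ring,
    show -Ω + δ = -(Ω - δ) by ring, neg_div, neg_lt_neg_iff] at hl
  rw [mul_div_assoc (2 * Real.pi / lam), mul_div_assoc (2 * Real.pi / lam)]
  exact ⟨mul_lt_mul_of_pos_left hl hk, mul_lt_mul_of_pos_left (lt_add_div_sqrt hΩ hδ) hk⟩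
end

section
/- If 0 < Ω < 1, then for every δ > 0 the diffusion interval is wider on the side of smaller wave-number: k·Ω − k·(Ω − δ)/√(1 + δ² − 2δΩ) > k·(Ω + δ)/√(1 + δ² + 2δΩ) − k·Ω. -/
/-- The two distances `a`, `b` from a point of the unit circle to `(± δ, 0)` have sum exceeding
`2`, unless the three points are collinear. -/
lemma two_lt_add_of_sq_eq {a b δ Ω : ℝ} (ha : 0 < a) (hb : 0 < b) (hδ : 0 < δ)
    (hΩ₀ : 0 < Ω) (hΩ₁ : Ω < 1) (ha2 : a ^ 2 = 1 + δ ^ 2 + 2 * δ * Ω)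
    (hb2 : b ^ 2 = 1 + δ ^ 2 - 2 * δ * Ω) : 2 < a + b := by
  have hab : 0 < a * b := mul_pos ha hb
  have h_sq : (1 - δ ^ 2) ^ 2 < (a * b) ^ 2 := by
    have h : (a * b) ^ 2 = (1 - δ ^ 2) ^ 2 + 4 * (δ ^ 2 * (1 - Ω ^ 2)) := by
      rw [mul_pow, ha2, hb2]; ring
    have hpos : 0 < δ ^ 2 * (1 - Ω ^ 2) := mul_pos (by positivity) (by nlinarith)
    linarith
  have h_lt : 1 - δ ^ 2 < a * b := lt_of_pow_lt_pow_left₀ 2 hab.le h_sq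
  nlinarith

lemma add_div_add_sub_div_lt {a b δ Ω : ℝ} (ha : 0 < a) (hb : 0 < b) (hδ : 0 < δ)
    (hΩ₀ : 0 < Ω) (hΩ₁ : Ω < 1) (ha2 : a ^ 2 = 1 + δ ^ 2 + 2 * δ * Ω)
    (hb2 : b ^ 2 = 1 + δ ^ 2 - 2 * δ * Ω) : (Ω + δ) / a + (Ω - δ) / b < 2 * Ω := by
  have hsum : 2 < a + b := two_lt_add_of_sq_eq ha hb hδ hΩ₀ hΩ₁ ha2 hb2
  have hab : 0 < a * b := mul_pos ha hb
  have hδΩ : 0 < δ * Ω := mul_pos hδ hΩ₀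
  have hba : 0 < a - b := by nlinarith
  have h_four : 0 < (a - b) ^ 2 + 2 * (a * b) * (a + b) - 4 := by nlinarith
  have h_prod := mul_pos hba h_four
  have h_id : 4 * δ * (2 * Ω * (a * b) - ((Ω + δ) * b + a * (Ω - δ))) =
      (a - b) * ((a - b) ^ 2 + 2 * (a * b) * (a + b) - 4) := by
    have h₁ : δ * Ω = (a ^ 2 - b ^ 2) / 4 := by linarith
    have h₂ : δ ^ 2 = (a ^ 2 + b ^ 2) / 2 - 1 := by linarith
    linear_combination (8 * a * b - 4 * a - 4 * b) * h₁ + (4 * a - 4 * b) * h₂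
  rw [div_add_div _ _ ha.ne' hb.ne', div_lt_iff₀ hab]
  rw [← h_id] at h_prod
  linarith [pos_of_mul_pos_right h_prod (by positivity)]

/-- If `0 < Ω < 1`, then for every `δ > 0` the diffusion interval
is wider on the side of smaller wave-number:
`k·Ω − k·(Ω − δ)/√(1 + δ² − 2δΩ) > k·(Ω + δ)/√(1 + δ² + 2δΩ) − k·Ω`,
with `k = 2π/λ`. -/
theorem stmt_9 (lam : ℝ) (hlam : 0 < lam) (Ω : ℝ) (hΩ : Ω ∈ Set.Ioo (0 : ℝ) 1)
    (δ : ℝ) (hδ : 0 < δ) :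
    (2 * Real.pi / lam) * (Ω + δ) / Real.sqrt (1 + δ ^ 2 + 2 * δ * Ω) -
        (2 * Real.pi / lam) * Ω <
      (2 * Real.pi / lam) * Ω -
        (2 * Real.pi / lam) * (Ω - δ) / Real.sqrt (1 + δ ^ 2 - 2 * δ * Ω) := by
  obtain ⟨hΩ₀, hΩ₁⟩ := hΩ
  have hδΩ : 0 < δ * Ω := mul_pos hδ hΩ₀
  have hA : 0 < 1 + δ ^ 2 + 2 * δ * Ω := by nlinarith
  have hB : 0 < 1 + δ ^ 2 - 2 * δ * Ω := by nlinarith [sq_nonneg (δ - Ω)]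
  have h_main := add_div_add_sub_div_lt (Real.sqrt_pos.2 hA) (Real.sqrt_pos.2 hB) hδ hΩ₀ hΩ₁
    (Real.sq_sqrt hA.le) (Real.sq_sqrt hB.le)
  have hk : 0 < 2 * Real.pi / lam := div_pos (by positivity) hlam
  have h_scaled := mul_lt_mul_of_pos_left h_main hk
  rw [mul_add, ← mul_div_assoc, ← mul_div_assoc] at h_scaled
  linarith
end

section
/- The upper endpoint δ ↦ k·(Ω + δ)/√(1 + δ² + 2δΩ) is strictly increasing in δ on (0, ∞), the lower endpoint δ ↦ k·(Ω − δ)/√(1 + δ² − 2δΩ) is strictly decreasing in δ on (0, ∞), and consequently the width of the diffusion interval X_k is strictly increasing in δ (equivalently, the diffusion width strictly increases as the user distance r₀ decreases). -/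
/-- For `c > 0` the map `x ↦ x / √(x² + c)` is strictly increasing on the real line. -/
theorem strictMono_div_sqrt_sq_add {c : ℝ} (hc : 0 < c) :
    StrictMono (fun x : ℝ => x / Real.sqrt (x ^ 2 + c)) := by
  intro x y hxy
  have ha : 0 < Real.sqrt (x ^ 2 + c) := Real.sqrt_pos.2 (by positivity)
  have hb : 0 < Real.sqrt (y ^ 2 + c) := Real.sqrt_pos.2 (by positivity)
  have ha2 : Real.sqrt (x ^ 2 + c) ^ 2 = x ^ 2 + c := Real.sq_sqrt (by positivity)
  have hb2 : Real.sqrt (y ^ 2 + c) ^ 2 = y ^ 2 + c := Real.sq_sqrt (by positivity)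
  have hxa : |x| ≤ Real.sqrt (x ^ 2 + c) := Real.abs_le_sqrt (by linarith)
  have hyb : |y| ≤ Real.sqrt (y ^ 2 + c) := Real.abs_le_sqrt (by linarith)
  simp only
  generalize Real.sqrt (x ^ 2 + c) = a at *
  generalize Real.sqrt (y ^ 2 + c) = b at *
  have hprod : x * y ≤ a * b := calc
    x * y ≤ |x| * |y| := by rw [← abs_mul]; exact le_abs_self _
    _ ≤ a * b := by gcongr
  have key : (a + b) * (y * a - x * b) = (y - x) * (c + (a * b - x * y)) := by
    linear_combination y * ha2 - x * hb2
  have hpos : 0 < (a + b) * (y * a - x * b) := by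
    rw [key]
    exact mul_pos (sub_pos.2 hxy) (by linarith)
  rw [div_lt_div_iff₀ ha hb]
  exact sub_pos.1 ((mul_pos_iff_of_pos_left (add_pos ha hb)).1 hpos)

/-- The upper endpoint `δ ↦ k·(Ω + δ)/√(1 + δ² + 2δΩ)` is strictly
increasing on `(0, ∞)`, the lower endpoint `δ ↦ k·(Ω − δ)/√(1 + δ² − 2δΩ)` is
strictly decreasing on `(0, ∞)`, and consequently the width of the diffusion
interval is strictly increasing in `δ`.  Here `k = 2π/λ`. -/
theorem stmt_10 (lam : ℝ) (hlam : 0 < lam) (Ω : ℝ) (hΩ : Ω ∈ Set.Ioo (-1 : ℝ) 1) :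
    StrictMonoOn (fun δ : ℝ =>
        (2 * Real.pi / lam) * (Ω + δ) / Real.sqrt (1 + δ ^ 2 + 2 * δ * Ω))
      (Set.Ioi 0) ∧
    StrictAntiOn (fun δ : ℝ =>
        (2 * Real.pi / lam) * (Ω - δ) / Real.sqrt (1 + δ ^ 2 - 2 * δ * Ω))
      (Set.Ioi 0) ∧
    StrictMonoOn (fun δ : ℝ =>
        (2 * Real.pi / lam) * (Ω + δ) / Real.sqrt (1 + δ ^ 2 + 2 * δ * Ω) -
        (2 * Real.pi / lam) * (Ω - δ) / Real.sqrt (1 + δ ^ 2 - 2 * δ * Ω))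
      (Set.Ioi 0) := by
  have hc : 0 < 1 - Ω ^ 2 := by nlinarith [hΩ.1, hΩ.2]
  have hk : 0 < 2 * Real.pi / lam := by positivity
  have hupper : StrictMonoOn (fun δ : ℝ =>
      (2 * Real.pi / lam) * (Ω + δ) / Real.sqrt (1 + δ ^ 2 + 2 * δ * Ω)) (Set.Ioi 0) := by
    intro s _ t _ hst
    have h := mul_lt_mul_of_pos_left
      (strictMono_div_sqrt_sq_add hc (add_lt_add_right hst Ω)) hk
    convert h using 1 <;> simp only [mul_div_assoc] <;> ring_nf
  have hlower : StrictAntiOn (fun δ : ℝ =>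
      (2 * Real.pi / lam) * (Ω - δ) / Real.sqrt (1 + δ ^ 2 - 2 * δ * Ω)) (Set.Ioi 0) := by
    intro s _ t _ hst
    have h := mul_lt_mul_of_pos_left
      (strictMono_div_sqrt_sq_add hc (sub_lt_sub_left hst Ω)) hk
    convert h using 1 <;> simp only [mul_div_assoc] <;> ring_nf
  exact ⟨hupper, hlower, fun s hs t ht hst =>
    sub_lt_sub (hupper hs ht hst) (hlower hs ht hst)⟩
end

section
/- If |k_x| < k, then the distance from the stationary point to the user admits the closed form r(x_s) = r₀·k·√(1 − Ω²)/√(k² − k_x²), where x_s = r₀·(Ω − (k_x/√(k² − k_x²))·√(1 − Ω²)). -/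
/-- If `|k_x| < k` (with `k = 2π/λ`), then the distance from the
stationary point `x_s = r₀·(Ω − (k_x/√(k² − k_x²))·√(1 − Ω²))` to the user
admits the closed form `r(x_s) = r₀·k·√(1 − Ω²)/√(k² − k_x²)`, where
`r(x) = √(r₀² + x² − 2r₀xΩ)`. -/
theorem stmt_11 (lam : ℝ) (hlam : 0 < lam) (r0 : ℝ) (hr0 : 0 < r0)
    (Ω : ℝ) (hΩ : Ω ∈ Set.Ioo (-1 : ℝ) 1) (kx : ℝ)
    (hkx : |kx| < 2 * Real.pi / lam)
    (xs : ℝ)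
    (hxs : xs = r0 * (Ω - kx / Real.sqrt ((2 * Real.pi / lam) ^ 2 - kx ^ 2) *
      Real.sqrt (1 - Ω ^ 2))) :
    Real.sqrt (r0 ^ 2 + xs ^ 2 - 2 * r0 * xs * Ω) =
      r0 * (2 * Real.pi / lam) * Real.sqrt (1 - Ω ^ 2) /
        Real.sqrt ((2 * Real.pi / lam) ^ 2 - kx ^ 2) := by
  have hk : 0 < 2 * Real.pi / lam := (abs_nonneg kx).trans_lt hkx
  generalize 2 * Real.pi / lam = k at *
  have hkx2 : 0 < k ^ 2 - kx ^ 2 := sub_pos.mpr (sq_lt_sq.mpr (by rwa [abs_of_pos hk]))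
  have hs : 0 < Real.sqrt (k ^ 2 - kx ^ 2) := Real.sqrt_pos.mpr hkx2
  have hs2 := Real.sq_sqrt hkx2.le
  have hc : 0 ≤ 1 - Ω ^ 2 := by nlinarith [hΩ.1, hΩ.2]
  have hc2 := Real.sq_sqrt hc
  have hc0 := Real.sqrt_nonneg (1 - Ω ^ 2)
  generalize Real.sqrt (k ^ 2 - kx ^ 2) = s at *
  generalize Real.sqrt (1 - Ω ^ 2) = c at *
  have hsq : r0 ^ 2 + xs ^ 2 - 2 * r0 * xs * Ω = (r0 * k * c / s) ^ 2 := by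
    have hk2 : k ^ 2 = s ^ 2 + kx ^ 2 := by linarith
    calc r0 ^ 2 + xs ^ 2 - 2 * r0 * xs * Ω
        = r0 ^ 2 * (1 - Ω ^ 2) + (xs - r0 * Ω) ^ 2 := by ring
      _ = r0 ^ 2 * c ^ 2 + (r0 * (kx / s * c)) ^ 2 := by rw [← hc2, hxs]; ring
      _ = r0 ^ 2 * (s ^ 2 + kx ^ 2) * c ^ 2 / s ^ 2 := by field_simp
      _ = (r0 * k * c / s) ^ 2 := by rw [← hk2]; ring
  rw [hsq, Real.sqrt_sq (by positivity)]
end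

section
/- If |k_x| < k, then the phase at the stationary point admits the closed form ψ(x_s) = r₀·(k − k_x·Ω − √((1 − Ω²)·(k² − k_x²))), where ψ(x) = −k_x·x + k·(r₀ − r(x)) and x_s = r₀·(Ω − (k_x/√(k² − k_x²))·√(1 − Ω²)). -/
/-- If `|k_x| < k` (with `k = 2π/λ`), then the phase at the
stationary point admits the closed form
`ψ(x_s) = r₀·(k − k_x·Ω − √((1 − Ω²)·(k² − k_x²)))`, where
`ψ(x) = −k_x·x + k·(r₀ − r(x))`, `r(x) = √(r₀² + x² − 2r₀xΩ)`, and
`x_s = r₀·(Ω − (k_x/√(k² − k_x²))·√(1 − Ω²))`. -/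
theorem stmt_12 (lam : ℝ) (hlam : 0 < lam) (r0 : ℝ) (hr0 : 0 < r0)
    (Ω : ℝ) (hΩ : Ω ∈ Set.Ioo (-1 : ℝ) 1) (kx : ℝ)
    (hkx : |kx| < 2 * Real.pi / lam)
    (xs : ℝ)
    (hxs : xs = r0 * (Ω - kx / Real.sqrt ((2 * Real.pi / lam) ^ 2 - kx ^ 2) *
      Real.sqrt (1 - Ω ^ 2))) :
    -kx * xs + (2 * Real.pi / lam) *
        (r0 - Real.sqrt (r0 ^ 2 + xs ^ 2 - 2 * r0 * xs * Ω)) =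
      r0 * ((2 * Real.pi / lam) - kx * Ω -
        Real.sqrt ((1 - Ω ^ 2) * ((2 * Real.pi / lam) ^ 2 - kx ^ 2))) := by
  have hk : 0 < 2 * Real.pi / lam := (abs_nonneg kx).trans_lt hkx
  generalize 2 * Real.pi / lam = k at *
  have hS : 0 < 1 - Ω ^ 2 := by nlinarith [hΩ.1, hΩ.2]
  have hD : 0 < k ^ 2 - kx ^ 2 := by
    have := sq_lt_sq' (abs_lt.mp hkx).1 (abs_lt.mp hkx).2
    linarith
  rw [Real.sqrt_mul hS.le]
  have hS2 := Real.sq_sqrt hS.le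
  have hD2 := Real.sq_sqrt hD.le
  have hSpos := Real.sqrt_pos.mpr hS
  have hDpos := Real.sqrt_pos.mpr hD
  generalize √(1 - Ω ^ 2) = S at *
  generalize √(k ^ 2 - kx ^ 2) = D at *
  have hr : √(r0 ^ 2 + xs ^ 2 - 2 * r0 * xs * Ω) = r0 * S * k / D := by
    rw [← Real.sqrt_sq (by positivity : 0 ≤ r0 * S * k / D)]
    congr 1
    have hk2 : k ^ 2 = D ^ 2 + kx ^ 2 := by linarith
    have hΩ2 : Ω ^ 2 = 1 - S ^ 2 := by linarith
    calc r0 ^ 2 + xs ^ 2 - 2 * r0 * xs * Ω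
        = r0 ^ 2 * (1 - Ω ^ 2) + (r0 * (kx / D * S)) ^ 2 := by rw [hxs]; ring
      _ = r0 ^ 2 * S ^ 2 * (D ^ 2 + kx ^ 2) / D ^ 2 := by
        rw [hΩ2]; field_simp; ring
      _ = (r0 * S * k / D) ^ 2 := by rw [← hk2]; ring
  rw [hr, hxs]
  field_simp
  linear_combination S * hD2
end

section
/- If |k_x| < k, then the amplitude of the stationary-phase approximation admits the closed form √(2π/|ψ''(x_s)|)·A(x_s) = √(2π·r₀/(√(1 − Ω²)·√(k² − k_x²))), where A(x) = r₀/r(x), ψ''(x) = −k·r₀²·(1 − Ω²)/r(x)³, and x_s = r₀·(Ω − (k_x/√(k² − k_x²))·√(1 − Ω²)). -/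
/-- If `|k_x| < k` (with `k = 2π/λ`), then the amplitude of the
stationary-phase approximation admits the closed form
`√(2π/|ψ''(x_s)|)·A(x_s) = √(2π·r₀/(√(1 − Ω²)·√(k² − k_x²)))`, where
`A(x) = r₀/r(x)`, `ψ''(x) = −k·r₀²·(1 − Ω²)/r(x)³`,
`r(x) = √(r₀² + x² − 2r₀xΩ)`, and
`x_s = r₀·(Ω − (k_x/√(k² − k_x²))·√(1 − Ω²))`. -/
theorem stmt_13 (lam : ℝ) (hlam : 0 < lam) (r0 : ℝ) (hr0 : 0 < r0)
    (Ω : ℝ) (hΩ : Ω ∈ Set.Ioo (-1 : ℝ) 1) (kx : ℝ)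
    (hkx : |kx| < 2 * Real.pi / lam)
    (r : ℝ → ℝ) (hr : ∀ x, r x = Real.sqrt (r0 ^ 2 + x ^ 2 - 2 * r0 * x * Ω))
    (xs : ℝ)
    (hxs : xs = r0 * (Ω - kx / Real.sqrt ((2 * Real.pi / lam) ^ 2 - kx ^ 2) *
      Real.sqrt (1 - Ω ^ 2))) :
    Real.sqrt (2 * Real.pi /
        |(-(2 * Real.pi / lam) * r0 ^ 2 * (1 - Ω ^ 2) / (r xs) ^ 3)|) *
      (r0 / r xs) =
    Real.sqrt (2 * Real.pi * r0 /
      (Real.sqrt (1 - Ω ^ 2) * Real.sqrt ((2 * Real.pi / lam) ^ 2 - kx ^ 2))) := by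
  have hk : 0 < 2 * Real.pi / lam := by positivity
  generalize 2 * Real.pi / lam = k at *
  obtain ⟨hΩ₁, hΩ₂⟩ := hΩ
  have hΩ_pos : 0 < 1 - Ω ^ 2 := by nlinarith
  have hkx_pos : 0 < k ^ 2 - kx ^ 2 := sub_pos.2 (sq_lt_sq' (abs_lt.1 hkx).1 (abs_lt.1 hkx).2)
  have hs := Real.sqrt_pos.2 hΩ_pos
  have hq := Real.sqrt_pos.2 hkx_pos
  have hs_sq := Real.sq_sqrt hΩ_pos.le
  have hq_sq := Real.sq_sqrt hkx_pos.le
  generalize Real.sqrt (1 - Ω ^ 2) = s at *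
  generalize Real.sqrt (k ^ 2 - kx ^ 2) = q at *
  have hr_xs : r xs = r0 * k * s / q := by
    rw [hr, Real.sqrt_eq_iff_mul_self_eq_of_pos (by positivity)]
    have hk_sq : k ^ 2 = q ^ 2 + kx ^ 2 := by linarith
    have hlhs : r0 * k * s / q * (r0 * k * s / q) = r0 ^ 2 * s ^ 2 * (1 + (kx / q) ^ 2) := by
      field_simp
      linear_combination hk_sq
    rw [hlhs, hxs]
    linear_combination r0 ^ 2 * hs_sq
  rw [hr_xs, ← hs_sq, neg_mul, neg_mul, neg_div, abs_neg, abs_of_pos (by positivity),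
    ← Real.sqrt_sq (show 0 ≤ r0 / (r0 * k * s / q) by positivity),
    ← Real.sqrt_mul (by positivity)]
  congr 1
  field_simp
end
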